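/- Let d ≥ 1, n = 2^d, and let k be an integer with 1 ≤ k ≤ n. Then every aligned subarray of the Pascal toroidal array A_d of size n·2^{kn/2} × n·2^{kn/2} is a (k,n,n,n)-perfect toroidal array. -/

import Mathlib

/-- Entries of the Pascal-triangle matrix `M_d` (block recursive definition),
indexed by natural numbers. -/
def MdEnt : ℕ → ℕ → ℕ → ZMod 2
  | 0, _, _ => 1
  | d+1, i, j =>
    if i < 2 ^ d then
      if j < 2 ^ d then MdEnt d i j else MdEnt d i (j - 2 ^ d)
    else
      if j < 2 ^ d then 0 else MdEnt d (i - 2 ^ d) (j - 2 ^ d)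

/-- The matrix `M_d` over `𝔽₂`: `M_0 = (1)` and `M_{d+1} = [[M_d, M_d],[0, M_d]]`. -/
def Md (d : ℕ) : Matrix (Fin (2 ^ d)) (Fin (2 ^ d)) (ZMod 2) :=
  Matrix.of fun i j => MdEnt d (i : ℕ) (j : ℕ)

/-- The `s × t` array `P` occurs at position `(k, l)` in the toroidal array `A`. -/
def Occurs {N s t : ℕ} (A : ZMod N → ZMod N → ZMod 2)
    (P : Fin s → Fin t → ZMod 2) (k l : ZMod N) : Prop :=
  ∀ (i : Fin s) (j : Fin t), A (k + ((i : ℕ) : ZMod N)) (l + ((j : ℕ) : ZMod N)) = P i j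

/-- The toroidal array `A` of size `N × N` is `(s,t,p,q)`-perfect. -/
def IsPerfect (N s t p q : ℕ) (A : ZMod N → ZMod N → ZMod 2) : Prop :=
  ∀ (P : Fin s → Fin t → ZMod 2) (a b : ℕ), a < p → b < q →
    ∃! kl : Fin N × Fin N,
      (kl.1 : ℕ) % p = a ∧ (kl.2 : ℕ) % q = b ∧
        Occurs A P (((kl.1 : ℕ) : ZMod N)) (((kl.2 : ℕ) : ZMod N))

/-- `B` is an aligned subarray of `A` of size `L × L` (where `L` divides `N`). -/
def IsAlignedSub (N L : ℕ) (A : ZMod N → ZMod N → ZMod 2)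
    (B : ZMod L → ZMod L → ZMod 2) : Prop :=
  ∃ p q : ℕ, p < N / L ∧ q < N / L ∧
    ∀ (x y : Fin L),
      B ((x : ℕ) : ZMod L) ((y : ℕ) : ZMod L) =
        A (((p * L + (x : ℕ) : ℕ) : ZMod N)) (((q * L + (y : ℕ) : ℕ) : ZMod N))

/-- Nestedness of an `(n,n,n,n)`-perfect toroidal array of size
`n·2^{n²/2} × n·2^{n²/2}`. -/
def IsNested (n : ℕ)
    (A : ZMod (n * 2 ^ (n ^ 2 / 2)) → ZMod (n * 2 ^ (n ^ 2 / 2)) → ZMod 2) : Prop :=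
  ∀ k, 1 ≤ k → k ≤ n →
    ∀ B : ZMod (n * 2 ^ (n * k / 2)) → ZMod (n * 2 ^ (n * k / 2)) → ZMod 2,
      IsAlignedSub (n * 2 ^ (n ^ 2 / 2)) (n * 2 ^ (n * k / 2)) A B →
        IsPerfect (n * 2 ^ (n * k / 2)) k n n n B

/-- A nested `(n,n,n,n)`-perfect toroidal array. -/
def IsNestedPerfect (n : ℕ)
    (A : ZMod (n * 2 ^ (n ^ 2 / 2)) → ZMod (n * 2 ^ (n ^ 2 / 2)) → ZMod 2) : Prop :=
  IsPerfect (n * 2 ^ (n ^ 2 / 2)) n n n n A ∧ IsNested n A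

/-- `σ`: rotate a column vector downward by one step,
`(a_1,…,a_n) ↦ (a_n,a_1,…,a_{n-1})`. -/
def sigmaStep {n : ℕ} [NeZero n] (C : Fin n → ZMod 2) : Fin n → ZMod 2 :=
  fun i => C (i - 1)

instance instNeZeroTwoPow (d : ℕ) : NeZero (2 ^ d) := ⟨(Nat.two_pow_pos d).ne'⟩

/-- Admissibility of a sequence of rotation amounts `m_0,…,m_{n-1}`:
`m_{n-1} = 0` and `m_{i+1} ≤ m_i ≤ m_{i+1} + 1`. -/
def Admissible {n : ℕ} (m : Fin n → ℕ) : Prop :=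
  (∀ i : Fin n, (i : ℕ) = n - 1 → m i = 0) ∧
  ∀ i j : Fin n, (j : ℕ) = (i : ℕ) + 1 → m j ≤ m i ∧ m i ≤ m j + 1

/-- The Pascal-like matrix `M_d^{m_0,…,m_{n-1}}`: column `j` of `M_d`
rotated by `σ^{m_j}`. -/
def pascalLike (d : ℕ) (m : Fin (2 ^ d) → ℕ) :
    Matrix (Fin (2 ^ d)) (Fin (2 ^ d)) (ZMod 2) :=
  Matrix.of fun i j => (sigmaStep^[m j] (fun r => Md d r j)) i

/-- `M_{i,j}` lies in the upper border of `M`: it is the topmost `1` of its column. -/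
def UpperBorder {n : ℕ} (M : Matrix (Fin n) (Fin n) (ZMod 2)) (i j : Fin n) : Prop :=
  M i j = 1 ∧ ∀ r : Fin n, r < i → M r j = 0

/-- The enumeration `N_k` of all `n × n` matrices over `𝔽₂`:
entry `(i,j)` of `N_k` is the binary digit of `k` at position `n²−1−(i·n+j)`. -/
def Nmat (n k : ℕ) : Matrix (Fin n) (Fin n) (ZMod 2) :=
  Matrix.of fun i j =>
    if Nat.testBit k (n ^ 2 - 1 - ((i : ℕ) * n + (j : ℕ))) then 1 else 0

/-- The integer whose binary digit at position `t` is the digit of `k` at position `2t`. -/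
def evenPart (k : ℕ) : ℕ :=
  ∑ t ∈ Finset.range k, if Nat.testBit k (2 * t) then 2 ^ t else 0

/-- The integer whose binary digit at position `t` is the digit of `k` at position `2t+1`. -/
def oddPart (k : ℕ) : ℕ :=
  ∑ t ∈ Finset.range k, if Nat.testBit k (2 * t + 1) then 2 ^ t else 0

/-- The integer whose odd-position binary digits are those of `l` and whose
even-position binary digits are those of `m`; inverse of `k ↦ (oddPart k, evenPart k)`. -/
def joinOE (l m : ℕ) : ℕ :=
  ∑ t ∈ Finset.range (l + m + 1),
    ((if Nat.testBit l t then 2 ^ (2 * t + 1) else 0) +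
      (if Nat.testBit m t then 2 ^ (2 * t) else 0))

/-- The Pascal toroidal array `A_d` of size `n·2^{n²/2} × n·2^{n²/2}` (`n = 2^d`):
the matrix `M_d·N_k` is placed with upper left corner at `(odd(k)·n, even(k)·n)`. -/
def pascalArray (d : ℕ) :
    ZMod (2 ^ d * 2 ^ ((2 ^ d) ^ 2 / 2)) → ZMod (2 ^ d * 2 ^ ((2 ^ d) ^ 2 / 2)) → ZMod 2 :=
  fun x y =>
    (Md d * Nmat (2 ^ d) (joinOE (x.val / 2 ^ d) (y.val / 2 ^ d)))
      ⟨x.val % 2 ^ d, Nat.mod_lt _ (Nat.two_pow_pos d)⟩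
      ⟨y.val % 2 ^ d, Nat.mod_lt _ (Nat.two_pow_pos d)⟩

/-- The `(n,n,n,n)`-affine toroidal array determined by the Pascal-like matrix
given by rotations `m` and the matrix `Z`: the matrix `M·N_k ⊕ Z` is placed with
upper left corner at `(odd(k)·n, even(k)·n)`. -/
def affineArray (d : ℕ) (m : Fin (2 ^ d) → ℕ)
    (Z : Matrix (Fin (2 ^ d)) (Fin (2 ^ d)) (ZMod 2)) :
    ZMod (2 ^ d * 2 ^ ((2 ^ d) ^ 2 / 2)) → ZMod (2 ^ d * 2 ^ ((2 ^ d) ^ 2 / 2)) → ZMod 2 :=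
  fun x y =>
    (pascalLike d m * Nmat (2 ^ d) (joinOE (x.val / 2 ^ d) (y.val / 2 ^ d)) + Z)
      ⟨x.val % 2 ^ d, Nat.mod_lt _ (Nat.two_pow_pos d)⟩
      ⟨y.val % 2 ^ d, Nat.mod_lt _ (Nat.two_pow_pos d)⟩

lemma MdEnt_zero_left (d : ℕ) : ∀ j, j < 2 ^ d → MdEnt d 0 j = 1 := by
  induction d with
  | zero => intro j _; simp [MdEnt]
  | succ d ih =>
    intro j hj
    have h0 : 0 < 2 ^ d := Nat.two_pow_pos d
    rw [pow_succ] at hj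
    unfold MdEnt
    rw [if_pos h0]
    split_ifs with h
    · exact ih j h
    · exact ih _ (by omega)

lemma MdEnt_lower (d : ℕ) : ∀ i j, i < 2 ^ d → j < i → MdEnt d i j = 0 := by
  induction d with
  | zero => intro i j hi hj; simp at hi; omega
  | succ d ih =>
    intro i j hi hj
    rw [pow_succ] at hi
    unfold MdEnt
    split_ifs with h1 h2 h2
    · exact ih i j h1 hj
    · omega
    · rfl
    · exact ih _ _ (by omega) (by omega)

lemma MdEnt_last (d : ℕ) : ∀ i, i < 2 ^ d → MdEnt d i (2 ^ d - 1) = 1 := by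
  induction d with
  | zero => intro i _; simp [MdEnt]
  | succ d ih =>
    intro i hi
    have h0 : 0 < 2 ^ d := Nat.two_pow_pos d
    have e : 2 ^ (d+1) - 1 = 2 ^ d + (2 ^ d - 1) := by rw [pow_succ]; omega
    rw [pow_succ] at hi
    rw [e]
    unfold MdEnt
    rw [if_neg (by omega : ¬ 2 ^ d + (2 ^ d - 1) < 2 ^ d),
      if_neg (by omega : ¬ 2 ^ d + (2 ^ d - 1) < 2 ^ d), Nat.add_sub_cancel_left]
    split_ifs with h1
    · exact ih i h1
    · exact ih _ (by omega)

lemma MdEnt_diag (d : ℕ) : ∀ i, i < 2 ^ d → MdEnt d i i = 1 := by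
  induction d with
  | zero => intro i _; simp [MdEnt]
  | succ d ih =>
    intro i hi
    rw [pow_succ] at hi
    unfold MdEnt
    split_ifs with h1
    · exact ih i h1
    · exact ih _ (by omega)

lemma zmod2_add_self (x : ZMod 2) : x + x = 0 := by
  revert x; decide

lemma MdEnt_rec (d : ℕ) : ∀ i j, i + 1 < 2 ^ d → j + 1 < 2 ^ d →
    MdEnt d i j + MdEnt d (i + 1) j = MdEnt d (i + 1) (j + 1) := by
  induction d with
  | zero => intro i j hi; simp at hi
  | succ d ih =>
    intro i j hi hj
    have h0 : 0 < 2 ^ d := Nat.two_pow_pos d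
    rw [pow_succ] at hi hj
    rcases lt_trichotomy (i + 1) (2 ^ d) with hi1 | hi1 | hi1
    · rcases lt_trichotomy (j + 1) (2 ^ d) with hj1 | hj1 | hj1
      · have := ih i j hi1 hj1
        simpa [MdEnt, hi1, hj1, show i < 2 ^ d by omega, show j < 2 ^ d by omega] using this
      · have ej : j = 2 ^ d - 1 := by omega
        have e1 := MdEnt_last d i (by omega)
        have e2 := MdEnt_last d (i+1) (by omega)
        have e3 := MdEnt_lower d (i+1) 0 (by omega) (by omega)
        rw [← ej] at e1 e2
        simp only [MdEnt, hi1, hj1, show i < 2 ^ d by omega, show j < 2 ^ d by omega,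
          if_true, lt_irrefl, if_false, Nat.sub_self, e1, e2, e3]
        decide
      · have := ih i (j - 2 ^ d) hi1 (by omega)
        have e : j + 1 - 2 ^ d = j - 2 ^ d + 1 := by omega
        simpa [MdEnt, hi1, show i < 2 ^ d by omega, show ¬ j < 2 ^ d by omega,
          show ¬ j + 1 < 2 ^ d by omega, e] using this
    · rcases lt_trichotomy (j + 1) (2 ^ d) with hj1 | hj1 | hj1
      · have e1 := MdEnt_lower d i j (by omega) (by omega)
        simp only [MdEnt, hi1, hj1, show i < 2 ^ d by omega, show j < 2 ^ d by omega,
          if_true, lt_irrefl, if_false, e1, add_zero]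
      · have e1 := MdEnt_diag d i (by omega)
        have e0 := MdEnt_zero_left d 0 (by omega)
        have ej : j = i := by omega
        subst ej
        simp only [MdEnt, hi1, show j < 2 ^ d by omega,
          if_true, lt_irrefl, if_false, e1, e0, add_zero, Nat.sub_self]
      · have e1 := MdEnt_lower d i (j - 2 ^ d) (by omega) (by omega)
        have e0 := MdEnt_zero_left d (j - 2 ^ d) (by omega)
        have e2 := MdEnt_zero_left d (j + 1 - 2 ^ d) (by omega)
        simp only [MdEnt, hi1, show i < 2 ^ d by omega, show ¬ j < 2 ^ d by omega,
          show ¬ j + 1 < 2 ^ d by omega,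
          if_true, lt_irrefl, if_false, e1, e0, e2, zero_add, Nat.sub_self]
    · have ei : i + 1 - 2 ^ d = i - 2 ^ d + 1 := by omega
      rcases lt_trichotomy (j + 1) (2 ^ d) with hj1 | hj1 | hj1
      · simp only [MdEnt, hj1, show ¬ i < 2 ^ d by omega, show ¬ i + 1 < 2 ^ d by omega,
          show j < 2 ^ d by omega, if_true, if_false, add_zero]
      · have e1 := MdEnt_lower d (i - 2 ^ d + 1) 0 (by omega) (by omega)
        simp only [MdEnt, hj1, show ¬ i < 2 ^ d by omega, show ¬ i + 1 < 2 ^ d by omega,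
          show j < 2 ^ d by omega, if_true, if_false, add_zero, lt_irrefl, Nat.sub_self, ei, e1]
      · have := ih (i - 2 ^ d) (j - 2 ^ d) (by omega) (by omega)
        have e : j + 1 - 2 ^ d = j - 2 ^ d + 1 := by omega
        simpa [MdEnt, show ¬ i < 2 ^ d by omega, show ¬ i + 1 < 2 ^ d by omega,
          show ¬ j < 2 ^ d by omega, show ¬ j + 1 < 2 ^ d by omega, e, ei] using this

/-- Entry `t mod n` of `M_d v`. -/
def Wv (d : ℕ) (v : ℕ → ZMod 2) (t : ℕ) : ZMod 2 :=
  ∑ c ∈ Finset.range (2 ^ d), MdEnt d (t % 2 ^ d) c * v c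

/-- Shift of a vector. -/
def shiftV (v : ℕ → ZMod 2) : ℕ → ZMod 2
  | 0 => 0
  | c + 1 => v c

lemma Wv_step (d : ℕ) (v : ℕ → ZMod 2) (t : ℕ) :
    Wv d v t + Wv d v (t + 1) = Wv d (shiftV v) (t + 1) := by
  unfold Wv
  rw [← Finset.sum_add_distrib]
  have h0 : 0 < 2 ^ d := Nat.two_pow_pos d
  obtain ⟨m, hm⟩ : ∃ m, 2 ^ d = m + 1 := ⟨2 ^ d - 1, by omega⟩
  have hml : ∀ i, i < 2 ^ d → MdEnt d i m = 1 := by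
    intro i hi
    have := MdEnt_last d i hi
    rwa [show 2 ^ d - 1 = m by omega] at this
  have hr : ∀ t : ℕ, t % 2 ^ d < 2 ^ d := fun t => Nat.mod_lt _ h0
  have hL : ∑ c ∈ Finset.range (2 ^ d), (MdEnt d (t % 2 ^ d) c * v c
      + MdEnt d ((t + 1) % 2 ^ d) c * v c) =
      ∑ c ∈ Finset.range m, (MdEnt d (t % 2 ^ d) c * v c
      + MdEnt d ((t + 1) % 2 ^ d) c * v c) := by
    conv_lhs => rw [hm]
    rw [Finset.sum_range_succ, ← hm, hml _ (hr _), hml _ (hr _), zmod2_add_self, add_zero]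
  have hR : ∑ c ∈ Finset.range (2 ^ d), MdEnt d ((t + 1) % 2 ^ d) c * shiftV v c =
      ∑ c ∈ Finset.range m, MdEnt d ((t + 1) % 2 ^ d) (c + 1) * v c := by
    conv_lhs => rw [hm]
    rw [Finset.sum_range_succ', ← hm]
    simp [shiftV]
  rw [hL, hR]
  apply Finset.sum_congr rfl
  intro c hc
  rw [Finset.mem_range] at hc
  rw [← add_mul]
  congr 1
  have hmod := Nat.add_mod t 1 (2 ^ d)
  by_cases hlast : t % 2 ^ d = m
  · have e : (t + 1) % 2 ^ d = 0 := by
      rw [← Nat.mod_add_mod, hlast, ← hm, Nat.mod_self]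
    rw [e, hlast, MdEnt_lower d m c (by omega) hc, MdEnt_zero_left d _ (by omega),
      MdEnt_zero_left d _ (by omega), zero_add]
  · have := hr t
    have e : (t + 1) % 2 ^ d = t % 2 ^ d + 1 := by
      rw [← Nat.mod_add_mod, Nat.mod_eq_of_lt (by omega)]
    rw [e]
    exact MdEnt_rec d _ _ (by omega) (by omega)

lemma Wv_periodic (d : ℕ) (v : ℕ → ZMod 2) (t : ℕ) : Wv d v (t + 2 ^ d) = Wv d v t := by
  simp [Wv]

lemma Wv_all_zero (d k : ℕ) : ∀ (v : ℕ → ZMod 2) (a : ℕ), k ≤ 2 ^ d →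
    (∀ c, c < 2 ^ d - k → v c = 0) → (∀ i, i < k → Wv d v (a + i) = 0) →
    ∀ t, Wv d v t = 0 := by
  induction k with
  | zero =>
    intro v a _ hv _ t
    unfold Wv
    apply Finset.sum_eq_zero
    intro c hc
    rw [hv c (by simpa using hc), mul_zero]
  | succ k ih =>
    intro v a hk hv hw
    have h1 := ih (shiftV v) (a + 1) (by omega)
      (by
        intro c hc
        cases c with
        | zero => rfl
        | succ c => exact hv c (by omega))
      (by
        intro i hi
        have := Wv_step d v (a + i)
        rw [hw i (by omega), show a + i + 1 = a + (i + 1) by ring, hw (i+1) (by omega)] at this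
        rw [show a + 1 + i = a + (i + 1) by ring, ← this, add_zero])
    have hstep : ∀ t, Wv d v (t + 1) = Wv d v t := by
      intro t
      have := Wv_step d v t
      rw [h1] at this
      have h2 : ∀ x y : ZMod 2, x + y = 0 → y = x := by decide
      exact h2 _ _ this
    have hconst : ∀ t, Wv d v t = Wv d v 0 := by
      intro t
      induction t with
      | zero => rfl
      | succ t iht => rw [hstep, iht]
    intro t
    have := hw 0 (by omega)
    rw [hconst] at this
    rw [hconst, this]

lemma v_zero_of_Wv (d : ℕ) (v : ℕ → ZMod 2) (h : ∀ t, Wv d v t = 0) :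
    ∀ c, c < 2 ^ d → v c = 0 := by
  have key : ∀ s, ∀ c, c < 2 ^ d → 2 ^ d ≤ c + s → v c = 0 := by
    intro s
    induction s with
    | zero => intro c h1 h2; omega
    | succ s ih =>
      intro c hc hs
      have hw := h c
      unfold Wv at hw
      rw [Nat.mod_eq_of_lt hc, Finset.sum_eq_single c, MdEnt_diag d c hc, one_mul] at hw
      · exact hw
      · intro c' hc' hne
        rw [Finset.mem_range] at hc'
        rcases Nat.lt_or_gt_of_ne hne with h1 | h1
        · rw [MdEnt_lower d c c' hc h1, zero_mul]
        · rw [ih c' hc' (by omega), mul_zero]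
      · intro hn; exact absurd (Finset.mem_range.mpr hc) hn
  intro c hc
  exact key (2 ^ d) c hc (by omega)

lemma Wv_key (d k : ℕ) (v : ℕ → ZMod 2) (a : ℕ) (hk : k ≤ 2 ^ d)
    (hv : ∀ c, c < 2 ^ d - k → v c = 0) (hw : ∀ i, i < k → Wv d v (a + i) = 0) :
    ∀ c, c < 2 ^ d → v c = 0 :=
  v_zero_of_Wv d v (Wv_all_zero d k v a hk hv hw)

lemma Wv_sub (d : ℕ) (u v : ℕ → ZMod 2) (t : ℕ) :
    Wv d (fun c => u c - v c) t = Wv d u t - Wv d v t := by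
  simp [Wv, mul_sub, Finset.sum_sub_distrib]

/-- two-vector form of the key lemma -/
lemma Wv_key2 (d k : ℕ) (u v : ℕ → ZMod 2) (a : ℕ) (hk : k ≤ 2 ^ d)
    (hv : ∀ c, c < 2 ^ d - k → u c = v c)
    (hw : ∀ i, i < k → Wv d u (a + i) = Wv d v (a + i)) :
    ∀ c, c < 2 ^ d → u c = v c := by
  intro c hc
  have := Wv_key d k (fun c => u c - v c) a hk
    (fun c hc => by simp [hv c hc]) (fun i hi => by rw [Wv_sub, hw i hi, sub_self]) c hc
  exact sub_eq_zero.mp this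

/-- rows `≥ a` see only columns `≥ a` -/
lemma Wv_congr_ge (d : ℕ) (u v : ℕ → ZMod 2) (t : ℕ) (ht : t < 2 ^ d)
    (h : ∀ c, t ≤ c → c < 2 ^ d → u c = v c) : Wv d u t = Wv d v t := by
  unfold Wv
  rw [Nat.mod_eq_of_lt ht]
  apply Finset.sum_congr rfl
  intro c hc
  rw [Finset.mem_range] at hc
  by_cases h1 : c < t
  · rw [MdEnt_lower d t c ht h1, zero_mul, zero_mul]
  · rw [h c (by omega) hc]

lemma modEq_succ_of_testBit (s x y : ℕ) (h : x ≡ y [MOD 2 ^ s])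
    (hb : x.testBit s = y.testBit s) : x ≡ y [MOD 2 ^ (s + 1)] := by
  unfold Nat.ModEq at *
  rw [Nat.testBit_eq_decide_div_mod_eq, Nat.testBit_eq_decide_div_mod_eq,
    decide_eq_decide] at hb
  have h2 : x / 2 ^ s % 2 = y / 2 ^ s % 2 := by omega
  rw [Nat.mod_pow_succ, Nat.mod_pow_succ, h, h2]

lemma modEq_of_bits (m x y : ℕ)
    (h : ∀ t, t < m → ∃ e, (x + e).testBit t = (y + e).testBit t) :
    x ≡ y [MOD 2 ^ m] := by
  induction m with
  | zero => simp [Nat.modEq_one]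
  | succ m ih =>
    have h1 := ih (fun t ht => h t (by omega))
    obtain ⟨e, he⟩ := h m (by omega)
    exact Nat.ModEq.add_right_cancel' e (modEq_succ_of_testBit m _ _ (h1.add_right e) he)

lemma testBit_of_modEq (m x y t : ℕ) (h : x ≡ y [MOD 2 ^ m]) (ht : t < m) :
    x.testBit t = y.testBit t := by
  have hx := Nat.testBit_mod_two_pow x m t
  have hy := Nat.testBit_mod_two_pow y m t
  rw [h] at hx
  rw [hx] at hy
  simpa [ht] using hy

lemma join_aux (T : ℕ) : ∀ l m t : ℕ,
    ((∑ t ∈ Finset.range T, ((if Nat.testBit l t then 2 ^ (2 * t + 1) else 0) +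
      (if Nat.testBit m t then 2 ^ (2 * t) else 0))).testBit (2 * t + 1)
        = (decide (t < T) && l.testBit t)) ∧
    ((∑ t ∈ Finset.range T, ((if Nat.testBit l t then 2 ^ (2 * t + 1) else 0) +
      (if Nat.testBit m t then 2 ^ (2 * t) else 0))).testBit (2 * t)
        = (decide (t < T) && m.testBit t)) := by
  induction T with
  | zero => intro l m t; simp
  | succ T ih =>
    intro l m t
    have hs : ∑ t ∈ Finset.range (T + 1), ((if Nat.testBit l t then 2 ^ (2 * t + 1) else 0) +
      (if Nat.testBit m t then 2 ^ (2 * t) else 0)) =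
      4 * (∑ t ∈ Finset.range T, ((if Nat.testBit (l / 2) t then 2 ^ (2 * t + 1) else 0) +
      (if Nat.testBit (m / 2) t then 2 ^ (2 * t) else 0))) + (2 * (l % 2) + m % 2) := by
      rw [Finset.sum_range_succ', Finset.mul_sum]
      congr 1
      · apply Finset.sum_congr rfl
        intro t _
        rw [Nat.testBit_succ, Nat.testBit_succ]
        split_ifs <;> ring
      · simp only [Nat.testBit_zero, decide_eq_true_eq]
        split_ifs <;> simp <;> omega
    rw [hs]
    have := ih (l / 2) (m / 2)
    generalize (∑ t ∈ Finset.range T, ((if Nat.testBit (l / 2) t then 2 ^ (2 * t + 1) else 0) +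
      (if Nat.testBit (m / 2) t then 2 ^ (2 * t) else 0))) = S at this
    cases t with
    | zero =>
      rw [Nat.testBit_succ]
      simp only [Nat.mul_zero, Nat.testBit_zero]
      constructor
      · simp; omega
      · simp; omega
    | succ t =>
      rw [show 2 * (t + 1) + 1 = 2 * t + 1 + 1 + 1 by ring, show 2 * (t + 1) = 2 * t + 1 + 1 by ring]
      simp only [Nat.testBit_succ l, Nat.testBit_succ m]
      have two : ∀ Z u : ℕ, Z.testBit (u + 1 + 1) = (Z / 2 / 2).testBit u := by
        intro Z u
        rw [Nat.testBit_succ, Nat.testBit_succ]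
      have e : (4 * S + (2 * (l % 2) + m % 2)) / 2 / 2 = S := by omega
      rw [two _ (2 * t + 1), two _ (2 * t), e]
      simpa using this t

lemma joinOE_odd (l m t : ℕ) : (joinOE l m).testBit (2 * t + 1) = l.testBit t := by
  unfold joinOE
  rw [(join_aux _ l m t).1]
  by_cases h : t < l + m + 1
  · simp [h]
  · have : l < 2 ^ t := lt_of_lt_of_le (by omega) (Nat.lt_two_pow_self (n := t)).le
    simp [h, Nat.testBit_lt_two_pow this]

lemma joinOE_even (l m t : ℕ) : (joinOE l m).testBit (2 * t) = m.testBit t := by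
  unfold joinOE
  rw [(join_aux _ l m t).2]
  by_cases h : t < l + m + 1
  · simp [h]
  · have : m < 2 ^ t := lt_of_lt_of_le (by omega) (Nat.lt_two_pow_self (n := t)).le
    simp [h, Nat.testBit_lt_two_pow this]

/-- Entries of column `j` determined by the block coordinate `Z`. -/
def colE (n h Z j c : ℕ) : ZMod 2 :=
  if Z.testBit ((n - 1 - c) * h + (h - 1 - j / 2)) then 1 else 0

lemma Nmat_eq (n h X Y : ℕ) (hn : n = 2 * h) (i j : Fin n) :
    Nmat n (joinOE X Y) i j = colE n h (if (j : ℕ) % 2 = 0 then X else Y) j i := by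
  unfold Nmat colE
  simp only [Matrix.of_apply]
  have hi := i.isLt
  have hj := j.isLt
  generalize (i : ℕ) = i at *
  generalize (j : ℕ) = j at *
  obtain ⟨r, hr⟩ : ∃ r, n = i + 1 + r := ⟨n - 1 - i, by omega⟩
  have hr' : n - 1 - i = r := by omega
  have hsq : n ^ 2 = i * n + n + 2 * (r * h) := by
    have : n ^ 2 = (i + 1 + r) * n := by rw [sq, ← hr]
    rw [this]
    have : r * n = 2 * (r * h) := by rw [hn]; ring
    rw [add_mul, add_mul, this]; ring
  rw [hr']
  by_cases hp : j % 2 = 0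
  · have e : n ^ 2 - 1 - (i * n + j) = 2 * (r * h + (h - 1 - j / 2)) + 1 := by omega
    rw [e, joinOE_odd, if_pos hp]
  · have e : n ^ 2 - 1 - (i * n + j) = 2 * (r * h + (h - 1 - j / 2)) := by omega
    rw [e, joinOE_even, if_neg hp]

lemma pascalArray_nat (d h x y : ℕ) (hh : 2 ^ d = 2 * h)
    (hx : x < 2 ^ d * 2 ^ ((2 ^ d) ^ 2 / 2)) (hy : y < 2 ^ d * 2 ^ ((2 ^ d) ^ 2 / 2)) :
    pascalArray d (x : ZMod _) (y : ZMod _) =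
      Wv d (colE (2 ^ d) h (if y % 2 ^ d % 2 = 0 then x / 2 ^ d else y / 2 ^ d) (y % 2 ^ d)) x := by
  unfold pascalArray Wv
  rw [Matrix.mul_apply]
  simp only [Nmat_eq _ h _ _ hh, ZMod.val_natCast_of_lt hx, ZMod.val_natCast_of_lt hy, Md,
    Matrix.of_apply]
  exact Fin.sum_univ_eq_sum_range (fun c => MdEnt d (x % 2 ^ d) c *
    colE (2 ^ d) h (if y % 2 ^ d % 2 = 0 then x / 2 ^ d else y / 2 ^ d) (y % 2 ^ d) c) (2 ^ d)

/-- fixed part -/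
lemma colE_high (n h k p Z Z' j c : ℕ) (hZ : Z < 2 ^ (h * k)) (hZ' : Z' < 2 ^ (h * k))
    (hc : c < n - k) :
    colE n h (p * 2 ^ (h * k) + Z) j c = colE n h (p * 2 ^ (h * k) + Z') j c := by
  unfold colE
  have hle : h * k ≤ (n - 1 - c) * h + (h - 1 - j / 2) := by
    have : k * h ≤ (n - 1 - c) * h := Nat.mul_le_mul_right h (by omega)
    rw [mul_comm h k]; omega
  rw [mul_comm p, Nat.testBit_two_pow_mul_add _ hZ, Nat.testBit_two_pow_mul_add _ hZ',
    if_neg (not_lt.mpr hle), if_neg (not_lt.mpr hle)]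

lemma colE_bit (n h Z Z' j c : ℕ) (he : colE n h Z j c = colE n h Z' j c) :
    Z.testBit ((n - 1 - c) * h + (h - 1 - j / 2)) =
      Z'.testBit ((n - 1 - c) * h + (h - 1 - j / 2)) := by
  unfold colE at he
  split_ifs at he <;> simp_all

lemma testBit_low (m p Z e t : ℕ) (ht : t < m) :
    (p * 2 ^ m + (Z + e) % 2 ^ m).testBit t = (Z + e).testBit t := by
  apply testBit_of_modEq m _ _ _ _ ht
  unfold Nat.ModEq
  rw [mul_comm, Nat.mul_add_mod, Nat.mod_mod]

/-- value of column `j` of the block `Z + e` in the subarray -/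
def cw (d h k p Z j e t : ℕ) : ZMod 2 :=
  Wv d (colE (2 ^ d) h (p * 2 ^ (h * k) + (Z + e) % 2 ^ (h * k)) j) t

/-- decode bit position -/
lemma decode (n h s t : ℕ) (hn : n = 2 * h) (hs : s ≤ n) (ht : t < h * s) (par : ℕ)
    (hpar : par < 2) :
    ∃ j c, j < n ∧ j % 2 = par ∧ c < n ∧ n - s ≤ c ∧
      (n - 1 - c) * h + (h - 1 - j / 2) = t := by
  have hh : 0 < h := by
    rcases Nat.eq_zero_or_pos h with h0 | h0
    · subst h0; simp at ht
    · exact h0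
  have h1 : t / h < s := Nat.div_lt_of_lt_mul ht
  have h2 : t % h < h := Nat.mod_lt _ hh
  have h3 := Nat.div_add_mod t h
  generalize t / h = u at *
  generalize t % h = w at *
  refine ⟨2 * (h - 1 - w) + par, n - 1 - u, by omega, by omega, by omega, by omega, ?_⟩
  have e1 : n - 1 - (n - 1 - u) = u := by omega
  have e2 : h - 1 - (2 * (h - 1 - w) + par) / 2 = w := by omega
  rw [e1, e2, mul_comm]
  exact h3

lemma Y_inj (d h k q a Y1 Y2 : ℕ) (hh : 2 ^ d = 2 * h) (hk : k ≤ 2 ^ d)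
    (H : ∀ j, j < 2 ^ d → j % 2 = 1 → ∃ e, ∀ i, i < k →
      cw d h k q Y1 j e (a + i) = cw d h k q Y2 j e (a + i)) :
    Y1 ≡ Y2 [MOD 2 ^ (h * k)] := by
  apply modEq_of_bits
  intro t ht
  obtain ⟨j, c, hj, hjp, hc, hck, htt⟩ := decode (2 ^ d) h k t hh hk ht 1 (by omega)
  obtain ⟨e, he⟩ := H j hj hjp
  refine ⟨e, ?_⟩
  have hp : 0 < 2 ^ (h * k) := Nat.two_pow_pos _
  have := Wv_key2 d k _ _ a hk (fun c hc => colE_high (2 ^ d) h k q _ _ j c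
    (Nat.mod_lt (Y1 + e) hp) (Nat.mod_lt (Y2 + e) hp) hc) he c hc
  have := colE_bit _ _ _ _ _ _ this
  rwa [htt, testBit_low _ _ _ _ _ ht, testBit_low _ _ _ _ _ ht] at this

lemma X_inj (d h k p a X1 X2 : ℕ) (hh : 2 ^ d = 2 * h) (hk : k ≤ 2 ^ d) (ha : a < 2 ^ d)
    (H : ∀ j, j < 2 ^ d → j % 2 = 0 → ∀ i, i < k →
      cw d h k p X1 j ((a + i) / 2 ^ d) (a + i) = cw d h k p X2 j ((a + i) / 2 ^ d) (a + i)) :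
    X1 ≡ X2 [MOD 2 ^ (h * k)] := by
  have hp : 0 < 2 ^ (h * k) := Nat.two_pow_pos _
  by_cases hak : a + k ≤ 2 ^ d
  · apply modEq_of_bits
    intro t ht
    obtain ⟨j, c, hj, hjp, hc, hck, htt⟩ := decode (2 ^ d) h k t hh hk ht 0 (by omega)
    refine ⟨0, ?_⟩
    have := Wv_key2 d k _ _ a hk (fun c hc => colE_high (2 ^ d) h k p _ _ j c
      (Nat.mod_lt (X1 + 0) hp) (Nat.mod_lt (X2 + 0) hp) hc) (fun i hi => by
        have := H j hj hjp i hi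
        rwa [Nat.div_eq_of_lt (by omega)] at this) c hc
    have := colE_bit _ _ _ _ _ _ this
    rwa [htt, testBit_low _ _ _ _ _ ht, testBit_low _ _ _ _ _ ht] at this
  · have hsk : 2 ^ d - a ≤ k := by omega
    have hle : h * (2 ^ d - a) ≤ h * k := Nat.mul_le_mul_left h hsk
    have hlow : X1 ≡ X2 [MOD 2 ^ (h * (2 ^ d - a))] := by
      apply modEq_of_bits
      intro t ht
      obtain ⟨j, c, hj, hjp, hc, hck, htt⟩ :=
        decode (2 ^ d) h (2 ^ d - a) t hh (by omega) ht 0 (by omega)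
      refine ⟨0, ?_⟩
      let f : ℕ → ℕ → ZMod 2 := fun X c =>
        if c < a then 0 else colE (2 ^ d) h (p * 2 ^ (h * k) + (X + 0) % 2 ^ (h * k)) j c
      have hf : ∀ X i, i < 2 ^ d - a → Wv d (f X) (a + i) = cw d h k p X j 0 (a + i) := by
        intro X i hi
        apply Wv_congr_ge _ _ _ _ (by omega)
        intro c h1 h2
        simp only [f]
        rw [if_neg (by omega)]
      have := Wv_key2 d (2 ^ d - a) (f X1) (f X2) a (by omega)
        (fun c hc => by simp only [f]; rw [if_pos (by omega), if_pos (by omega)])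
        (fun i hi => by
          have := H j hj hjp i (by omega)
          rw [Nat.div_eq_of_lt (by omega)] at this
          rw [hf _ _ hi, hf _ _ hi, this]) c hc
      simp only [f] at this
      rw [if_neg (by omega), if_neg (by omega)] at this
      have := colE_bit _ _ _ _ _ _ this
      rwa [htt, testBit_low _ _ _ _ _ (by omega), testBit_low _ _ _ _ _ (by omega)] at this
    apply modEq_of_bits
    intro t ht
    obtain ⟨j, c, hj, hjp, hc, hck, htt⟩ := decode (2 ^ d) h k t hh hk ht 0 (by omega)
    refine ⟨1, ?_⟩
    have := Wv_key2 d k _ _ a hk (fun c hc => colE_high (2 ^ d) h k p _ _ j c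
      (Nat.mod_lt (X1 + 1) hp) (Nat.mod_lt (X2 + 1) hp) hc) (fun i hi => by
        by_cases hi2 : a + i < 2 ^ d
        · apply Wv_congr_ge _ _ _ _ hi2
          intro c h1 h2
          unfold colE
          have hb : (2 ^ d - 1 - c) * h + (h - 1 - j / 2) < h * (2 ^ d - a) := by
            have h3 : (2 ^ d - 1 - c + 1) * h ≤ (2 ^ d - a) * h :=
              Nat.mul_le_mul_right h (by omega)
            rw [mul_comm h]
            rw [add_mul] at h3
            omega
          rw [testBit_low _ _ _ _ _ (by omega), testBit_low _ _ _ _ _ (by omega),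
            testBit_of_modEq _ _ _ _ (hlow.add_right 1) hb]
        · have := H j hj hjp i hi
          have e1 : (a + i) / 2 ^ d = 1 := by
            rw [Nat.div_eq_iff (by omega)]; omega
          rwa [e1] at this) c hc
    have := colE_bit _ _ _ _ _ _ this
    rwa [htt, testBit_low _ _ _ _ _ ht, testBit_low _ _ _ _ _ ht] at this

/-- For `d ≥ 1`, `n = 2^d` and `1 ≤ k ≤ n`, every aligned subarray of
the Pascal toroidal array `A_d` of size `n·2^{kn/2} × n·2^{kn/2}` is a
`(k,n,n,n)`-perfect toroidal array. -/
theorem pascalArray_aligned_perfect (d k : ℕ) (hd : 1 ≤ d) (hk1 : 1 ≤ k)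
    (hk2 : k ≤ 2 ^ d) :
    ∀ B : ZMod (2 ^ d * 2 ^ (2 ^ d * k / 2)) → ZMod (2 ^ d * 2 ^ (2 ^ d * k / 2)) → ZMod 2,
      IsAlignedSub (2 ^ d * 2 ^ ((2 ^ d) ^ 2 / 2)) (2 ^ d * 2 ^ (2 ^ d * k / 2))
        (pascalArray d) B →
      IsPerfect (2 ^ d * 2 ^ (2 ^ d * k / 2)) k (2 ^ d) (2 ^ d) (2 ^ d) B := by
  obtain ⟨h, hh⟩ : ∃ h, 2 ^ d = 2 * h := ⟨2 ^ (d - 1), by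
    rw [← pow_succ']; congr 1; omega⟩
  have eK : 2 ^ d * k / 2 = h * k := by
    rw [hh, mul_assoc, Nat.mul_div_cancel_left _ (by norm_num)]
  rw [eK]
  rintro B ⟨p, q, hp, hq, hB⟩ P a b ha hb
  have hn : 0 < 2 ^ d := Nat.two_pow_pos d
  have hK : 0 < 2 ^ (h * k) := Nat.two_pow_pos _
  have hL : 0 < 2 ^ d * 2 ^ (h * k) := Nat.mul_pos hn hK
  have hlt : ∀ r x, r < 2 ^ d * 2 ^ ((2 ^ d) ^ 2 / 2) / (2 ^ d * 2 ^ (h * k)) →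
      x < 2 ^ d * 2 ^ (h * k) →
      r * (2 ^ d * 2 ^ (h * k)) + x < 2 ^ d * 2 ^ ((2 ^ d) ^ 2 / 2) := by
    intro r x hr hx
    have h1 := Nat.div_mul_le_self (2 ^ d * 2 ^ ((2 ^ d) ^ 2 / 2)) (2 ^ d * 2 ^ (h * k))
    have h2 := Nat.mul_le_mul_right (2 ^ d * 2 ^ (h * k)) (Nat.succ_le_of_lt hr)
    rw [Nat.succ_mul] at h2
    omega
  have hdiv : ∀ r x, (r * (2 ^ d * 2 ^ (h * k)) + x % (2 ^ d * 2 ^ (h * k))) / 2 ^ d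
      = r * 2 ^ (h * k) + x / 2 ^ d % 2 ^ (h * k) := by
    intro r x
    rw [show r * (2 ^ d * 2 ^ (h * k)) = 2 ^ d * (r * 2 ^ (h * k)) by ring,
      Nat.mul_add_div hn, Nat.mod_mul_right_div_self]
  have hmod : ∀ r x, (r * (2 ^ d * 2 ^ (h * k)) + x % (2 ^ d * 2 ^ (h * k))) % 2 ^ d
      = x % 2 ^ d := by
    intro r x
    rw [show r * (2 ^ d * 2 ^ (h * k)) = 2 ^ d * (r * 2 ^ (h * k)) by ring,
      Nat.mul_add_mod, Nat.mod_mul_right_mod]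
  have hBv : ∀ x y : ℕ, B (x : ZMod _) (y : ZMod _) =
      Wv d (colE (2 ^ d) h (if y % 2 ^ d % 2 = 0 then p * 2 ^ (h * k) + x / 2 ^ d % 2 ^ (h * k)
        else q * 2 ^ (h * k) + y / 2 ^ d % 2 ^ (h * k)) (y % 2 ^ d)) x := by
    intro x y
    have h1 := hB ⟨x % _, Nat.mod_lt x hL⟩ ⟨y % _, Nat.mod_lt y hL⟩
    simp only [ZMod.natCast_mod] at h1
    rw [h1, pascalArray_nat d h _ _ hh (hlt _ _ hp (Nat.mod_lt x hL))
      (hlt _ _ hq (Nat.mod_lt y hL)), hdiv, hdiv, hmod]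
    unfold Wv
    rw [hmod]
  -- the window map
  let F : Fin (2 ^ (h * k)) × Fin (2 ^ (h * k)) → (Fin k → Fin (2 ^ d) → ZMod 2) :=
    fun XY i j => B (((2 ^ d * (XY.1 : ℕ) + a + (i : ℕ) : ℕ)) : ZMod _)
      (((2 ^ d * (XY.2 : ℕ) + b + (j : ℕ) : ℕ)) : ZMod _)
  have hFinj : Function.Injective F := by
    rintro ⟨X1, Y1⟩ ⟨X2, Y2⟩ hF
    have hF' : ∀ i j, i < k → j < 2 ^ d →
        B (((2 ^ d * (X1 : ℕ) + a + i : ℕ)) : ZMod _) (((2 ^ d * (Y1 : ℕ) + b + j : ℕ)) : ZMod _) =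
        B (((2 ^ d * (X2 : ℕ) + a + i : ℕ)) : ZMod _)
          (((2 ^ d * (Y2 : ℕ) + b + j : ℕ)) : ZMod _) := by
      intro i j hi hj
      exact congrFun (congrFun hF ⟨i, hi⟩) ⟨j, hj⟩
    have hj : ∀ j, j < 2 ^ d → ∃ jj, jj < 2 ^ d ∧ (b + jj) % 2 ^ d = j := by
      intro j hj
      by_cases hbj : b ≤ j
      · exact ⟨j - b, by omega, by rw [Nat.mod_eq_of_lt] <;> omega⟩
      · refine ⟨j + 2 ^ d - b, by omega, ?_⟩
        rw [show b + (j + 2 ^ d - b) = j + 2 ^ d by omega, Nat.add_mod_right,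
          Nat.mod_eq_of_lt hj]
    have hW : ∀ v (X i : ℕ), Wv d v (2 ^ d * X + a + i) = Wv d v (a + i) := by
      intro v X i
      unfold Wv
      rw [add_assoc, Nat.mul_add_mod]
    have hX : (X1 : ℕ) ≡ X2 [MOD 2 ^ (h * k)] := by
      apply X_inj d h k p a X1 X2 hh hk2 ha
      intro j hj1 hj2 i hi
      obtain ⟨jj, hjj, hjj2⟩ := hj j hj1
      have := hF' i jj hi hjj
      rw [hBv, hBv, hW, hW] at this
      simp only [add_assoc, Nat.mul_add_mod, Nat.mul_add_div hn, hjj2] at this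
      rw [if_pos hj2, if_pos hj2] at this
      exact this
    have hY : (Y1 : ℕ) ≡ Y2 [MOD 2 ^ (h * k)] := by
      apply Y_inj d h k q a Y1 Y2 hh hk2
      intro j hj1 hj2
      obtain ⟨jj, hjj, hjj2⟩ := hj j hj1
      refine ⟨(b + jj) / 2 ^ d, ?_⟩
      intro i hi
      have := hF' i jj hi hjj
      rw [hBv, hBv, hW, hW] at this
      simp only [add_assoc, Nat.mul_add_mod, Nat.mul_add_div hn, hjj2] at this
      rw [if_neg (by omega), if_neg (by omega)] at this
      exact this
    have e1 := Nat.ModEq.eq_of_lt_of_lt hX X1.isLt X2.isLt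
    have e2 := Nat.ModEq.eq_of_lt_of_lt hY Y1.isLt Y2.isLt
    exact Prod.ext (Fin.ext e1) (Fin.ext e2)
  have hFbij : Function.Bijective F := by
    rw [Fintype.bijective_iff_injective_and_card]
    refine ⟨hFinj, ?_⟩
    simp only [Fintype.card_prod, Fintype.card_fin, Fintype.card_fun, ZMod.card]
    rw [← pow_add, ← pow_mul, hh]
    congr 1
    ring
  have hocc : ∀ (X Y : Fin (2 ^ (h * k))),
      Occurs B P (((2 ^ d * (X : ℕ) + a : ℕ)) : ZMod _) (((2 ^ d * (Y : ℕ) + b : ℕ)) : ZMod _) ↔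
        F (X, Y) = P := by
    intro X Y
    constructor
    · intro hO
      funext i j
      have := hO i j
      rw [← Nat.cast_add, ← Nat.cast_add] at this
      exact this
    · intro hO i j
      rw [← Nat.cast_add, ← Nat.cast_add, ← hO]
  have hbound : ∀ X c : ℕ, X < 2 ^ (h * k) → c < 2 ^ d → 2 ^ d * X + c < 2 ^ d * 2 ^ (h * k) := by
    intro X c hX hc
    have := Nat.mul_le_mul_left (2 ^ d) (Nat.succ_le_of_lt hX)
    rw [Nat.mul_succ] at this
    omega
  obtain ⟨⟨X, Y⟩, hXY⟩ := hFbij.2 P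
  refine ⟨(⟨2 ^ d * X + a, hbound _ _ X.isLt ha⟩, ⟨2 ^ d * Y + b, hbound _ _ Y.isLt hb⟩),
    ⟨?_, ?_, (hocc X Y).2 hXY⟩, ?_⟩
  · simp only [Nat.mul_add_mod]; exact Nat.mod_eq_of_lt ha
  · simp only [Nat.mul_add_mod]; exact Nat.mod_eq_of_lt hb
  · rintro ⟨x, y⟩ ⟨hx, hy, hO⟩
    have ex : (x : ℕ) = 2 ^ d * ((x : ℕ) / 2 ^ d) + a := by
      have := Nat.div_add_mod (x : ℕ) (2 ^ d)
      rw [show (x : ℕ) % 2 ^ d = a from hx] at this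
      exact this.symm
    have ey : (y : ℕ) = 2 ^ d * ((y : ℕ) / 2 ^ d) + b := by
      have := Nat.div_add_mod (y : ℕ) (2 ^ d)
      rw [show (y : ℕ) % 2 ^ d = b from hy] at this
      exact this.symm
    have hO2 : Occurs B P ((x : ℕ) : ZMod _) ((y : ℕ) : ZMod _) := hO
    rw [ex, ey] at hO2
    have := (hocc ⟨(x : ℕ) / 2 ^ d, Nat.div_lt_of_lt_mul x.isLt⟩
      ⟨(y : ℕ) / 2 ^ d, Nat.div_lt_of_lt_mul y.isLt⟩).1 hO2
    have h3 := hFinj (this.trans hXY.symm)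
    have h4 := congrArg (fun z => (z.1 : ℕ)) h3
    have h5 := congrArg (fun z => (z.2 : ℕ)) h3
    simp only at h4 h5
    rw [h4] at ex
    rw [h5] at ey
    exact Prod.ext (Fin.ext ex) (Fin.ext ey)
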